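/- Let n ≥ 1, let α_2,…,α_n be programs containing no variables, and let φ_1,…,φ_n, ψ_1,…,ψ_n be variable-free formulas. Let φ(x) = φ_1 ∨ (ψ_1 ∧ [α_2](φ_2 ∨ (ψ_2 ∧ … [α_n](φ_n ∨ (ψ_n ∧ x)) … ))). Then λ_1 := [(¬̄φ_1?;⨀_{i=2}^n α_i;¬̄φ_i?)*] ⋀_{j=1}^n [¬̄φ_1?;⨀_{k=2}^j α_k;¬̄φ_k?] ψ_j is a solution to the fixed-point equation x ≡ φ(x); that is, λ_1 contains no occurrence of x and λ_1 ≡ φ(λ_1) is valid. -/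

import Mathlib

mutual
inductive PDLFormula (P V A : Type) : Type
  | var : V → PDLFormula P V A
  | atom : P → PDLFormula P V A
  | natom : P → PDLFormula P V A
  | or : PDLFormula P V A → PDLFormula P V A → PDLFormula P V A
  | and : PDLFormula P V A → PDLFormula P V A → PDLFormula P V A
  | dia : PDLProgram P V A → PDLFormula P V A → PDLFormula P V A
  | box : PDLProgram P V A → PDLFormula P V A → PDLFormula P V A

inductive PDLProgram (P V A : Type) : Type
  | aprog : A → PDLProgram P V A
  | test : PDLFormula P V A → PDLProgram P V A
  | seq : PDLProgram P V A → PDLProgram P V A → PDLProgram P V A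
  | union : PDLProgram P V A → PDLProgram P V A → PDLProgram P V A
  | star : PDLProgram P V A → PDLProgram P V A
end

structure PDLModel (P V A : Type) where
  W : Type
  nonempty : Nonempty W
  R : A → W → W → Prop
  Vp : P → Set W
  Vv : V → Set W

mutual
def PDLModel.Sat {P V A : Type} (M : PDLModel P V A) : PDLFormula P V A → M.W → Prop
  | .var x => fun w => w ∈ M.Vv x
  | .atom p => fun w => w ∈ M.Vp p
  | .natom p => fun w => w ∉ M.Vp p
  | .or φ ψ => fun w => M.Sat φ w ∨ M.Sat ψ w
  | .and φ ψ => fun w => M.Sat φ w ∧ M.Sat ψ w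
  | .dia α φ => fun w => ∃ u, M.Rel α w u ∧ M.Sat φ u
  | .box α φ => fun w => ∀ u, M.Rel α w u → M.Sat φ u

def PDLModel.Rel {P V A : Type} (M : PDLModel P V A) : PDLProgram P V A → M.W → M.W → Prop
  | .aprog a => M.R a
  | .test φ => fun w u => w = u ∧ M.Sat φ w
  | .seq α β => fun w u => ∃ v, M.Rel α w v ∧ M.Rel β v u
  | .union α β => fun w u => M.Rel α w u ∨ M.Rel β w u
  | .star α => Relation.ReflTransGen (M.Rel α)
end

def PDLFormula.nneg {P V A : Type} : PDLFormula P V A → PDLFormula P V A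
  | .var x => .var x
  | .atom p => .natom p
  | .natom p => .atom p
  | .or φ ψ => .and φ.nneg ψ.nneg
  | .and φ ψ => .or φ.nneg ψ.nneg
  | .dia α φ => .box α φ.nneg
  | .box α φ => .dia α φ.nneg

mutual
def PDLFormula.noVar {P V A : Type} : PDLFormula P V A → Prop
  | .var _ => False
  | .atom _ => True
  | .natom _ => True
  | .or φ ψ => φ.noVar ∧ ψ.noVar
  | .and φ ψ => φ.noVar ∧ ψ.noVar
  | .dia α φ => α.noVar ∧ φ.noVar
  | .box α φ => α.noVar ∧ φ.noVar

def PDLProgram.noVar {P V A : Type} : PDLProgram P V A → Prop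
  | .aprog _ => True
  | .test φ => φ.noVar
  | .seq α β => α.noVar ∧ β.noVar
  | .union α β => α.noVar ∧ β.noVar
  | .star α => α.noVar
end

mutual
def PDLFormula.xFree {P V A : Type} (x : V) : PDLFormula P V A → Prop
  | .var y => y ≠ x
  | .atom _ => True
  | .natom _ => True
  | .or φ ψ => φ.xFree x ∧ ψ.xFree x
  | .and φ ψ => φ.xFree x ∧ ψ.xFree x
  | .dia α φ => α.xFree x ∧ φ.xFree x
  | .box α φ => α.xFree x ∧ φ.xFree x

def PDLProgram.xFree {P V A : Type} (x : V) : PDLProgram P V A → Prop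
  | .aprog _ => True
  | .test φ => φ.xFree x
  | .seq α β => α.xFree x ∧ β.xFree x
  | .union α β => α.xFree x ∧ β.xFree x
  | .star α => α.xFree x
end

mutual
def PDLFormula.subst {P V A : Type} [DecidableEq V] (x : V) (ψ : PDLFormula P V A) :
    PDLFormula P V A → PDLFormula P V A
  | .var y => if y = x then ψ else .var y
  | .atom p => .atom p
  | .natom p => .natom p
  | .or φ χ => .or (PDLFormula.subst x ψ φ) (PDLFormula.subst x ψ χ)
  | .and φ χ => .and (PDLFormula.subst x ψ φ) (PDLFormula.subst x ψ χ)
  | .dia α φ => .dia (PDLProgram.subst x ψ α) (PDLFormula.subst x ψ φ)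
  | .box α φ => .box (PDLProgram.subst x ψ α) (PDLFormula.subst x ψ φ)

def PDLProgram.subst {P V A : Type} [DecidableEq V] (x : V) (ψ : PDLFormula P V A) :
    PDLProgram P V A → PDLProgram P V A
  | .aprog a => .aprog a
  | .test φ => .test (PDLFormula.subst x ψ φ)
  | .seq α β => .seq (PDLProgram.subst x ψ α) (PDLProgram.subst x ψ β)
  | .union α β => .union (PDLProgram.subst x ψ α) (PDLProgram.subst x ψ β)
  | .star α => .star (PDLProgram.subst x ψ α)
end

/-- Nested box form: `[α_i](φ_i ∨ (ψ_i ∧ [α_{i+1}](…)))` with `m` levels starting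
at index `i`, and the variable `x` innermost. -/
def nestBoxOr {P V A : Type} (αs : ℕ → PDLProgram P V A) (φs ψs : ℕ → PDLFormula P V A)
    (x : V) : ℕ → ℕ → PDLFormula P V A
  | 0, _ => .var x
  | m + 1, i => .box (αs i) (.or (φs i) (.and (ψs i) (nestBoxOr αs φs ψs x m (i + 1))))

/-- Nested diamond form: `⟨α_i⟩(φ_i ∧ (ψ_i ∨ ⟨α_{i+1}⟩(…)))` with `m` levels starting
at index `i`, and the variable `x` innermost. -/
def nestDiaAnd {P V A : Type} (αs : ℕ → PDLProgram P V A) (φs ψs : ℕ → PDLFormula P V A)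
    (x : V) : ℕ → ℕ → PDLFormula P V A
  | 0, _ => .var x
  | m + 1, i => .dia (αs i) (.and (φs i) (.or (ψs i) (nestDiaAnd αs φs ψs x m (i + 1))))

/-- `seqPrefFrom base step j = base ; step 2 ; step 3 ; … ; step j` (left associated);
for `j ≤ 1` it is just `base`. -/
def seqPrefFrom {P V A : Type} (base : PDLProgram P V A) (step : ℕ → PDLProgram P V A) :
    ℕ → PDLProgram P V A
  | 0 => base
  | 1 => base
  | j + 2 => .seq (seqPrefFrom base step (j + 1)) (step (j + 2))

/-- `bigAndUp χ n = χ 1 ∧ χ 2 ∧ … ∧ χ n` (left associated); `bigAndUp χ 1 = χ 1`. -/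
def bigAndUp {P V A : Type} (χ : ℕ → PDLFormula P V A) : ℕ → PDLFormula P V A
  | 0 => χ 0
  | 1 => χ 1
  | j + 2 => .and (bigAndUp χ (j + 1)) (χ (j + 2))

/-- `bigOrUp χ n = χ 1 ∨ χ 2 ∨ … ∨ χ n` (left associated); `bigOrUp χ 1 = χ 1`. -/
def bigOrUp {P V A : Type} (χ : ℕ → PDLFormula P V A) : ℕ → PDLFormula P V A
  | 0 => χ 0
  | 1 => χ 1
  | j + 2 => .or (bigOrUp χ (j + 1)) (χ (j + 2))

mutual
theorem PDLFormula.noVar.xFree {P V A : Type} (x : V) :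
    ∀ φ : PDLFormula P V A, φ.noVar → φ.xFree x
  | .var _, h => by simp [PDLFormula.noVar] at h
  | .atom _, _ => by simp [PDLFormula.xFree]
  | .natom _, _ => by simp [PDLFormula.xFree]
  | .or φ ψ, h => by
      simp only [PDLFormula.noVar, PDLFormula.xFree] at h ⊢
      exact ⟨PDLFormula.noVar.xFree x φ h.1, PDLFormula.noVar.xFree x ψ h.2⟩
  | .and φ ψ, h => by
      simp only [PDLFormula.noVar, PDLFormula.xFree] at h ⊢
      exact ⟨PDLFormula.noVar.xFree x φ h.1, PDLFormula.noVar.xFree x ψ h.2⟩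
  | .dia α φ, h => by
      simp only [PDLFormula.noVar, PDLFormula.xFree] at h ⊢
      exact ⟨PDLProgram.noVar.xFree x α h.1, PDLFormula.noVar.xFree x φ h.2⟩
  | .box α φ, h => by
      simp only [PDLFormula.noVar, PDLFormula.xFree] at h ⊢
      exact ⟨PDLProgram.noVar.xFree x α h.1, PDLFormula.noVar.xFree x φ h.2⟩

theorem PDLProgram.noVar.xFree {P V A : Type} (x : V) :
    ∀ α : PDLProgram P V A, α.noVar → α.xFree x
  | .aprog _, _ => by simp [PDLProgram.xFree]
  | .test φ, h => by
      simp only [PDLProgram.noVar, PDLProgram.xFree] at h ⊢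
      exact PDLFormula.noVar.xFree x φ h
  | .seq α β, h => by
      simp only [PDLProgram.noVar, PDLProgram.xFree] at h ⊢
      exact ⟨PDLProgram.noVar.xFree x α h.1, PDLProgram.noVar.xFree x β h.2⟩
  | .union α β, h => by
      simp only [PDLProgram.noVar, PDLProgram.xFree] at h ⊢
      exact ⟨PDLProgram.noVar.xFree x α h.1, PDLProgram.noVar.xFree x β h.2⟩
  | .star α, h => by
      simp only [PDLProgram.noVar, PDLProgram.xFree] at h ⊢
      exact PDLProgram.noVar.xFree x α h
end

mutual
theorem PDLFormula.subst_of_xFree {P V A : Type} [DecidableEq V] (x : V)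
    (χ : PDLFormula P V A) :
    ∀ φ : PDLFormula P V A, φ.xFree x → PDLFormula.subst x χ φ = φ
  | .var _, h => by
      simp only [PDLFormula.xFree] at h
      simp [PDLFormula.subst, h]
  | .atom _, _ => by simp [PDLFormula.subst]
  | .natom _, _ => by simp [PDLFormula.subst]
  | .or φ ψ, h => by
      simp only [PDLFormula.xFree] at h
      simp only [PDLFormula.subst, PDLFormula.subst_of_xFree x χ φ h.1,
        PDLFormula.subst_of_xFree x χ ψ h.2]
  | .and φ ψ, h => by
      simp only [PDLFormula.xFree] at h
      simp only [PDLFormula.subst, PDLFormula.subst_of_xFree x χ φ h.1,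
        PDLFormula.subst_of_xFree x χ ψ h.2]
  | .dia α φ, h => by
      simp only [PDLFormula.xFree] at h
      simp only [PDLFormula.subst, PDLProgram.subst_of_xFree x χ α h.1,
        PDLFormula.subst_of_xFree x χ φ h.2]
  | .box α φ, h => by
      simp only [PDLFormula.xFree] at h
      simp only [PDLFormula.subst, PDLProgram.subst_of_xFree x χ α h.1,
        PDLFormula.subst_of_xFree x χ φ h.2]

theorem PDLProgram.subst_of_xFree {P V A : Type} [DecidableEq V] (x : V)
    (χ : PDLFormula P V A) :
    ∀ α : PDLProgram P V A, α.xFree x → PDLProgram.subst x χ α = α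
  | .aprog _, _ => by simp [PDLProgram.subst]
  | .test φ, h => by
      simp only [PDLProgram.xFree] at h
      simp only [PDLProgram.subst, PDLFormula.subst_of_xFree x χ φ h]
  | .seq α β, h => by
      simp only [PDLProgram.xFree] at h
      simp only [PDLProgram.subst, PDLProgram.subst_of_xFree x χ α h.1,
        PDLProgram.subst_of_xFree x χ β h.2]
  | .union α β, h => by
      simp only [PDLProgram.xFree] at h
      simp only [PDLProgram.subst, PDLProgram.subst_of_xFree x χ α h.1,
        PDLProgram.subst_of_xFree x χ β h.2]
  | .star α, h => by
      simp only [PDLProgram.xFree] at h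
      simp only [PDLProgram.subst, PDLProgram.subst_of_xFree x χ α h]
end

theorem PDLFormula.noVar.nneg {P V A : Type} :
    ∀ φ : PDLFormula P V A, φ.noVar → φ.nneg.noVar
  | .var _, h => by simp [PDLFormula.noVar] at h
  | .atom _, _ => by simp [PDLFormula.nneg, PDLFormula.noVar]
  | .natom _, _ => by simp [PDLFormula.nneg, PDLFormula.noVar]
  | .or φ ψ, h => by
      simp only [PDLFormula.noVar, PDLFormula.nneg] at h ⊢
      exact ⟨PDLFormula.noVar.nneg φ h.1, PDLFormula.noVar.nneg ψ h.2⟩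
  | .and φ ψ, h => by
      simp only [PDLFormula.noVar, PDLFormula.nneg] at h ⊢
      exact ⟨PDLFormula.noVar.nneg φ h.1, PDLFormula.noVar.nneg ψ h.2⟩
  | .dia _ φ, h => by
      simp only [PDLFormula.noVar, PDLFormula.nneg] at h ⊢
      exact ⟨h.1, PDLFormula.noVar.nneg φ h.2⟩
  | .box _ φ, h => by
      simp only [PDLFormula.noVar, PDLFormula.nneg] at h ⊢
      exact ⟨h.1, PDLFormula.noVar.nneg φ h.2⟩

theorem PDLModel.sat_nneg {P V A : Type} (M : PDLModel P V A) :
    ∀ (φ : PDLFormula P V A), φ.noVar → ∀ w : M.W, M.Sat φ.nneg w ↔ ¬ M.Sat φ w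
  | .var _, h, _ => by simp [PDLFormula.noVar] at h
  | .atom _, _, w => by simp [PDLFormula.nneg, PDLModel.Sat]
  | .natom _, _, w => by simp [PDLFormula.nneg, PDLModel.Sat]
  | .or φ ψ, h, w => by
      simp only [PDLFormula.noVar] at h
      simp only [PDLFormula.nneg, PDLModel.Sat, M.sat_nneg φ h.1, M.sat_nneg ψ h.2, not_or]
  | .and φ ψ, h, w => by
      simp only [PDLFormula.noVar] at h
      simp only [PDLFormula.nneg, PDLModel.Sat, M.sat_nneg φ h.1, M.sat_nneg ψ h.2,
        not_and_or]
  | .dia _ φ, h, w => by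
      simp only [PDLFormula.noVar] at h
      simp only [PDLFormula.nneg, PDLModel.Sat, M.sat_nneg φ h.2, not_exists, not_and]
  | .box _ φ, h, w => by
      simp only [PDLFormula.noVar] at h
      simp only [PDLFormula.nneg, PDLModel.Sat, M.sat_nneg φ h.2, not_forall, exists_prop]

theorem seqPrefFrom_succ {P V A : Type} (base : PDLProgram P V A)
    (step : ℕ → PDLProgram P V A) {j : ℕ} (hj : 1 ≤ j) :
    seqPrefFrom base step (j + 1) = .seq (seqPrefFrom base step j) (step (j + 1)) := by
  obtain ⟨k, rfl⟩ := Nat.exists_eq_add_of_le' hj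
  rfl

theorem bigAndUp_succ {P V A : Type} (χ : ℕ → PDLFormula P V A) {j : ℕ} (hj : 1 ≤ j) :
    bigAndUp χ (j + 1) = .and (bigAndUp χ j) (χ (j + 1)) := by
  obtain ⟨k, rfl⟩ := Nat.exists_eq_add_of_le' hj
  rfl

theorem seqPrefFrom_noVar {P V A : Type} {base : PDLProgram P V A}
    {step : ℕ → PDLProgram P V A} {n : ℕ} (hn : 1 ≤ n) (hbase : base.noVar)
    (hstep : ∀ i, 2 ≤ i → i ≤ n → (step i).noVar) : (seqPrefFrom base step n).noVar := by
  induction n, hn using Nat.le_induction with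
  | base => exact hbase
  | succ j hj ih =>
    rw [seqPrefFrom_succ _ _ hj]
    simp only [PDLProgram.noVar]
    exact ⟨ih fun i h2 hi => hstep i h2 (by omega), hstep _ (by omega) le_rfl⟩

theorem bigAndUp_noVar {P V A : Type} {χ : ℕ → PDLFormula P V A} {n : ℕ} (hn : 1 ≤ n)
    (hχ : ∀ i, 1 ≤ i → i ≤ n → (χ i).noVar) : (bigAndUp χ n).noVar := by
  induction n, hn using Nat.le_induction with
  | base => exact hχ 1 le_rfl le_rfl
  | succ j hj ih =>
    rw [bigAndUp_succ _ hj]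
    simp only [PDLFormula.noVar]
    exact ⟨ih fun i h1 hi => hχ i h1 (by omega), hχ _ (by omega) le_rfl⟩

theorem PDLModel.sat_bigAndUp {P V A : Type} (M : PDLModel P V A)
    (χ : ℕ → PDLFormula P V A) {n : ℕ} (hn : 1 ≤ n) (w : M.W) :
    M.Sat (bigAndUp χ n) w ↔ ∀ j, 1 ≤ j → j ≤ n → M.Sat (χ j) w := by
  induction n, hn using Nat.le_induction with
  | base =>
    refine ⟨fun h j h1 h2 => ?_, fun h => h 1 le_rfl le_rfl⟩
    obtain rfl : j = 1 := by omega
    exact h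
  | succ k hk ih =>
    rw [bigAndUp_succ _ hk]
    simp only [PDLModel.Sat, ih]
    refine ⟨fun h j h1 h2 => ?_, fun h => ⟨fun j h1 h2 => h j h1 (by omega),
      h _ (by omega) le_rfl⟩⟩
    rcases Nat.lt_or_ge k j with hj | hj
    · obtain rfl : j = k + 1 := by omega
      exact h.2
    · exact h.1 j h1 hj

theorem PDLModel.sat_box_star {P V A : Type} (M : PDLModel P V A) (α : PDLProgram P V A)
    (φ : PDLFormula P V A) (w : M.W) :
    M.Sat (.box (.star α) φ) w ↔
      M.Sat φ w ∧ ∀ v, M.Rel α w v → M.Sat (.box (.star α) φ) v := by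
  simp only [PDLModel.Sat, PDLModel.Rel]
  refine ⟨fun h => ⟨h w .refl, fun v hv u hu => h u (.head hv hu)⟩, fun h u hu => ?_⟩
  rcases hu.cases_head with rfl | ⟨v, hv, hvu⟩
  · exact h.1
  · exact h.2 v hv u hvu

/-- Unfolding the first `k` levels of the nested box form. -/
theorem PDLModel.sat_subst_nestBoxOr_iff {P V A : Type} [DecidableEq V] (M : PDLModel P V A)
    (x : V) (χ : PDLFormula P V A) {n : ℕ}
    (αs : ℕ → PDLProgram P V A) (φs ψs : ℕ → PDLFormula P V A)
    (hα : ∀ i, 2 ≤ i → i ≤ n → (αs i).noVar)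
    (hφ : ∀ i, 1 ≤ i → i ≤ n → (φs i).noVar)
    (hψ : ∀ i, 1 ≤ i → i ≤ n → (ψs i).noVar) {k : ℕ} (hk : 1 ≤ k) (hkn : k ≤ n) (w : M.W) :
    M.Sat (PDLFormula.subst x χ
        (.or (φs 1) (.and (ψs 1) (nestBoxOr αs φs ψs x (n - 1) 2)))) w ↔
      (∀ j, 1 ≤ j → j ≤ k → ∀ v,
        M.Rel (seqPrefFrom (.test (φs 1).nneg)
          (fun i => .seq (αs i) (.test (φs i).nneg)) j) w v → M.Sat (ψs j) v) ∧
      ∀ v, M.Rel (seqPrefFrom (.test (φs 1).nneg)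
          (fun i => .seq (αs i) (.test (φs i).nneg)) k) w v →
        M.Sat (PDLFormula.subst x χ (nestBoxOr αs φs ψs x (n - k) (k + 1))) v := by
  have hsφ (i : ℕ) (h1 : 1 ≤ i) (hi : i ≤ n) : PDLFormula.subst x χ (φs i) = φs i :=
    PDLFormula.subst_of_xFree x χ _ (PDLFormula.noVar.xFree x _ (hφ i h1 hi))
  have hsψ (i : ℕ) (h1 : 1 ≤ i) (hi : i ≤ n) : PDLFormula.subst x χ (ψs i) = ψs i :=
    PDLFormula.subst_of_xFree x χ _ (PDLFormula.noVar.xFree x _ (hψ i h1 hi))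
  induction k, hk using Nat.le_induction with
  | base =>
    simp only [PDLFormula.subst, hsφ 1 le_rfl hkn, hsψ 1 le_rfl hkn, PDLModel.Sat]
    have hneg := M.sat_nneg _ (hφ 1 le_rfl hkn) w
    constructor
    · intro h
      constructor
      · intro j h1 h2 v hv
        obtain rfl : j = 1 := by omega
        simp only [seqPrefFrom, PDLModel.Rel] at hv
        obtain ⟨rfl, hv⟩ := hv
        exact (h.resolve_left (hneg.1 hv)).1
      · intro v hv
        simp only [seqPrefFrom, PDLModel.Rel] at hv
        obtain ⟨rfl, hv⟩ := hv
        exact (h.resolve_left (hneg.1 hv)).2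
    · rintro ⟨h1, h2⟩
      by_cases hw : M.Sat (φs 1) w
      · exact .inl hw
      · have hr : M.Rel (seqPrefFrom (.test (φs 1).nneg)
            (fun i => .seq (αs i) (.test (φs i).nneg)) 1) w w := by
          simp only [seqPrefFrom, PDLModel.Rel]
          exact ⟨trivial, hneg.2 hw⟩
        exact .inr ⟨h1 1 le_rfl le_rfl w hr, h2 w hr⟩
  | succ k hk ih =>
    refine Iff.trans (ih (by omega)) ?_
    have hnk : n - k = n - (k + 1) + 1 := by omega
    have hsα : PDLProgram.subst x χ (αs (k + 1)) = αs (k + 1) :=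
      PDLProgram.subst_of_xFree x χ _ (PDLProgram.noVar.xFree x _ (hα _ (by omega) hkn))
    have hneg := M.sat_nneg _ (hφ (k + 1) (by omega) hkn)
    have hrel (v : M.W) : M.Rel (seqPrefFrom (.test (φs 1).nneg)
        (fun i => .seq (αs i) (.test (φs i).nneg)) (k + 1)) w v ↔
        ∃ u, M.Rel (seqPrefFrom (.test (φs 1).nneg)
          (fun i => .seq (αs i) (.test (φs i).nneg)) k) w u ∧
          M.Rel (αs (k + 1)) u v ∧ ¬ M.Sat (φs (k + 1)) v := by
      rw [seqPrefFrom_succ _ _ hk]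
      simp only [PDLModel.Rel, hneg]
      constructor
      · rintro ⟨u, hu, _, huv, rfl, hv⟩
        exact ⟨u, hu, huv, hv⟩
      · rintro ⟨u, hu, huv, hv⟩
        exact ⟨u, hu, v, huv, rfl, hv⟩
    rw [hnk]
    simp only [nestBoxOr, PDLFormula.subst, hsα, hsφ (k + 1) (by omega) hkn,
      hsψ (k + 1) (by omega) hkn, PDLModel.Sat]
    constructor
    · rintro ⟨h1, h2⟩
      have key (v : M.W) (hv : M.Rel (seqPrefFrom (.test (φs 1).nneg)
          (fun i => .seq (αs i) (.test (φs i).nneg)) (k + 1)) w v) :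
          M.Sat (ψs (k + 1)) v ∧ M.Sat (PDLFormula.subst x χ
            (nestBoxOr αs φs ψs x (n - (k + 1)) (k + 1 + 1))) v := by
        obtain ⟨u, hu, huv, hn⟩ := (hrel v).1 hv
        exact (h2 u hu v huv).resolve_left hn
      refine ⟨fun j hj1 hj v hv => ?_, fun v hv => (key v hv).2⟩
      rcases Nat.lt_or_ge k j with hkj | hkj
      · obtain rfl : j = k + 1 := by omega
        exact (key v hv).1
      · exact h1 j hj1 hkj v hv
    · rintro ⟨h1, h2⟩
      refine ⟨fun j hj1 hj => h1 j hj1 (by omega), fun u hu v huv => ?_⟩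
      by_cases hv : M.Sat (φs (k + 1)) v
      · exact .inl hv
      · have hr := (hrel v).2 ⟨u, hu, huv, hv⟩
        exact .inr ⟨h1 _ (by omega) le_rfl v hr, h2 v hr⟩

/-- for `n ≥ 1`, variable-free programs `α_2,…,α_n` and variable-free
formulas `φ_1,…,φ_n,ψ_1,…,ψ_n`, the formula
`λ₁ = [(¬̄φ_1?;⨀_{i=2}^n α_i;¬̄φ_i?)*] ⋀_{j=1}^n [¬̄φ_1?;⨀_{k=2}^j α_k;¬̄φ_k?] ψ_j`
is a solution of `x ≡ φ_1 ∨ (ψ_1 ∧ [α_2](φ_2 ∨ (ψ_2 ∧ … [α_n](φ_n ∨ (ψ_n ∧ x))…)))`. -/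
theorem lambda1_solves_even_Pi_form {P V A : Type} [DecidableEq V]
    (x : V) (n : ℕ) (hn : 1 ≤ n)
    (αs : ℕ → PDLProgram P V A) (φs ψs : ℕ → PDLFormula P V A)
    (hα : ∀ i, 2 ≤ i → i ≤ n → (αs i).noVar)
    (hφ : ∀ i, 1 ≤ i → i ≤ n → (φs i).noVar)
    (hψ : ∀ i, 1 ≤ i → i ≤ n → (ψs i).noVar) :
    let step : ℕ → PDLProgram P V A := fun i => .seq (αs i) (.test (φs i).nneg)
    let base : PDLProgram P V A := .test (φs 1).nneg
    let lam : PDLFormula P V A :=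
      .box (.star (seqPrefFrom base step n))
        (bigAndUp (fun j => .box (seqPrefFrom base step j) (ψs j)) n)
    let φx : PDLFormula P V A := .or (φs 1) (.and (ψs 1) (nestBoxOr αs φs ψs x (n - 1) 2))
    lam.xFree x ∧
      ∀ (M : PDLModel P V A) (w : M.W),
        M.Sat lam w ↔ M.Sat (PDLFormula.subst x lam φx) w := by
  intro step base lam φx
  have hpref (j : ℕ) (h1 : 1 ≤ j) (hj : j ≤ n) : (seqPrefFrom base step j).noVar := by
    refine seqPrefFrom_noVar h1 ?_ fun i h2 hi => ?_
    · simp only [base, PDLProgram.noVar]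
      exact PDLFormula.noVar.nneg _ (hφ 1 le_rfl hn)
    · simp only [step, PDLProgram.noVar]
      exact ⟨hα i h2 (by omega), PDLFormula.noVar.nneg _ (hφ i (by omega) (by omega))⟩
  constructor
  · apply PDLFormula.noVar.xFree
    simp only [lam, PDLFormula.noVar, PDLProgram.noVar]
    refine ⟨hpref n hn le_rfl, bigAndUp_noVar hn fun i h1 hi => ?_⟩
    simp only [PDLFormula.noVar]
    exact ⟨hpref i h1 hi, hψ i h1 hi⟩
  · intro M w
    rw [M.sat_subst_nestBoxOr_iff x lam αs φs ψs hα hφ hψ hn le_rfl w, M.sat_box_star,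
      M.sat_bigAndUp _ hn]
    simp only [Nat.sub_self, nestBoxOr, PDLFormula.subst, if_true]
    simp only [PDLModel.Sat, lam, step, base]
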